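/- The function f_R(τ) = 2^{12} η(2τ)^{24}/η(τ)^{24} + 24 is invariant under Γ₀(2): for every matrix (a b; c d) ∈ SL(2,ℤ) with c ≡ 0 (mod 2) and every τ in the upper half-plane, f_R((aτ+b)/(cτ+d)) = f_R(τ). -/

import Mathlib

open scoped Real

/-- The Dedekind eta function `η(τ) = e^{πiτ/12} ∏_{n=1}^∞ (1 - e^{2πinτ})`. -/
noncomputable def eta (τ : ℂ) : ℂ :=
  Complex.exp (Real.pi * Complex.I * τ / 12) *
    ∏' n : ℕ, (1 - Complex.exp (2 * Real.pi * Complex.I * (n + 1) * τ))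

/-- `f_NS(τ) = η(τ)^48/(η(τ/2)^24 η(2τ)^24) − 24`. -/
noncomputable def fNS (τ : ℂ) : ℂ :=
  eta τ ^ 48 / (eta (τ / 2) ^ 24 * eta (2 * τ) ^ 24) - 24

/-- `f̃_NS(τ) = η(τ/2)^24/η(τ)^24 + 24`. -/
noncomputable def ftNS (τ : ℂ) : ℂ :=
  eta (τ / 2) ^ 24 / eta τ ^ 24 + 24

/-- `f_R(τ) = 2^12 η(2τ)^24/η(τ)^24 + 24`. -/
noncomputable def fR (τ : ℂ) : ℂ :=
  2 ^ 12 * eta (2 * τ) ^ 24 / eta τ ^ 24 + 24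

theorem eta_eq_mathlib (z : ℂ) : eta z = ModularForm.eta z := by
  unfold eta ModularForm.eta
  congr 1
  · simp only [Function.Periodic.qParam]
    congr 1
    push_cast
    ring
  · simp only [ModularForm.eta_q_eq_cexp]

theorem eta_pow_transform (a b c d : ℤ) (hdet : a * d - b * c = 1) (τ : ℂ) (hτ : 0 < τ.im) :
    eta ((a * τ + b) / (c * τ + d)) ^ 24 = (c * τ + d) ^ 12 * eta τ ^ 24 := by
  let g : Matrix.SpecialLinearGroup (Fin 2) ℤ :=
    ⟨!![a, b; c, d], by rw [Matrix.det_fin_two_of]; exact hdet⟩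
  let z : UpperHalfPlane := ⟨τ, hτ⟩
  have h := SlashInvariantForm.slash_action_eqn' CuspForm.discriminant
    (MonoidHom.mem_range.mpr ⟨g, rfl⟩ :
      Matrix.SpecialLinearGroup.mapGL ℝ g ∈ (Matrix.SpecialLinearGroup.mapGL ℝ).range) z
  have hz : ((Matrix.SpecialLinearGroup.mapGL ℝ g • z : UpperHalfPlane) : ℂ)
      = (a * τ + b) / (c * τ + d) := by
    have h3 := UpperHalfPlane.coe_specialLinearGroup_apply g z
    simp [g, z] at h3
    exact h3
  have hc : (Matrix.SpecialLinearGroup.mapGL ℝ g) 1 0 = (c : ℝ) := rfl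
  have hd : (Matrix.SpecialLinearGroup.mapGL ℝ g) 1 1 = (d : ℝ) := rfl
  rw [CuspForm.coe_discriminant, hc, hd] at h
  simp only [ModularForm.discriminant, hz] at h
  rw [eta_eq_mathlib, eta_eq_mathlib, h]
  norm_cast

theorem den_ne_zero (a b c d : ℤ) (hdet : a * d - b * c = 1) (τ : ℂ) (hτ : 0 < τ.im) :
    (c * τ + d : ℂ) ≠ 0 := by
  intro h
  have him := congrArg Complex.im h
  have hre := congrArg Complex.re h
  simp at him hre
  rcases him with h0 | h0
  · subst h0
    simp at hre
    subst hre
    simp at hdet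
  · exact absurd h0 hτ.ne'

/-- `f_R` is invariant under `Γ₀(2)`. -/
theorem statement9 (a b c d : ℤ) (hdet : a * d - b * c = 1) (hc : 2 ∣ c)
    (τ : ℂ) (hτ : 0 < τ.im) :
    fR ((a * τ + b) / (c * τ + d)) = fR τ := by
  obtain ⟨e, rfl⟩ := hc
  have h1 := eta_pow_transform a b (2 * e) d hdet τ hτ
  have h2 := eta_pow_transform a (2 * b) e d (by linarith) (2 * τ) (by simpa using hτ)
  have h0 := den_ne_zero a b (2 * e) d hdet τ hτ
  have e2 : 2 * ((a * τ + b) / (((2 * e : ℤ) : ℂ) * τ + d))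
      = (a * (2 * τ) + ((2 * b : ℤ) : ℂ)) / (e * (2 * τ) + d) := by
    push_cast
    rw [← mul_div_assoc]
    congr 1 <;> ring
  have e3 : (e * (2 * τ) + d : ℂ) = ((2 * e : ℤ) : ℂ) * τ + d := by
    push_cast; ring
  unfold fR
  rw [e2, h2, h1, e3, mul_left_comm, mul_div_mul_left _ _ (pow_ne_zero 12 h0)]
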